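/- arXiv:0708.0511 — 2 statements merged into one kernel-verified Lean document; each statement's English description precedes it below -/
import Mathlib

section
/- (Existence of the N-th order quantum normal form at the level of symbols.) Let λ, ω₂, …, ω_d ∈ ℝ with λ ≠ 0, and set H₂ := λ·x₁ξ₁ + i·Σ_{k=2}^d ω_k·x_k ξ_k. Let H ∈ R be a polynomial whose weighted-homogeneous components H_s ∈ 𝒲^s (so H = Σ_s H_s) satisfy H₁ = 0 and H₂ as above, and let N ≥ 3. Then there exist W₃ ∈ 𝒲³, W₄ ∈ 𝒲⁴, …, W_N ∈ 𝒲^N such that, defining recursively H^{(2)}_s := H_s and, for 3 ≤ n ≤ N, H^{(n)}_s := Σ_{k=0}^{⌊s/(n−2)⌋} (1/k!)·(Mad_{W_n})^k H^{(n−1)}_{s−k(n−2)} (with H^{(n−1)}_t := 0 for t < 0), one has {H₂, H^{(N)}_s} = 0 for all 0 ≤ s ≤ N. -/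
open MvPolynomial

/-- Variables of the polynomial ring `R = ℂ[ħ, q₁, …, q_d, p₁, …, p_d]`:
`PVar.h` is `ħ`, `PVar.q k` is `q_k` and `PVar.p k` is `p_k`. -/
inductive PVar (d : ℕ) : Type where
  | h : PVar d
  | q : Fin d → PVar d
  | p : Fin d → PVar d
  deriving DecidableEq

/-- The commutative polynomial ring `R = ℂ[ħ, q₁, …, q_d, p₁, …, p_d]`. -/
abbrev Rpoly (d : ℕ) : Type := MvPolynomial (PVar d) ℂ

/-- `ħ` as an element of `R`. -/
noncomputable def hbar (d : ℕ) : Rpoly d := X PVar.h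

/-- The formal partial derivative with respect to a variable, as a linear endomorphism. -/
noncomputable def pd {d : ℕ} (v : PVar d) : Module.End ℂ (Rpoly d) :=
  (pderiv v).toLinearMap

/-- Iterated partial derivative `∂^μ` with respect to the family of variables `f`. -/
noncomputable def pdMulti {d : ℕ} (f : Fin d → PVar d) (μ : Fin d → ℕ) :
    Module.End ℂ (Rpoly d) :=
  (List.ofFn fun k => pd (f k) ^ μ k).prod

/-- The bidifferential operator
`P^n(A,B) = Σ_{μ,ν ∈ ℕ^d, |μ|+|ν|=n} (n!/(μ!·ν!)) (−1)^{|ν|} (∂_q^μ ∂_p^ν A)·(∂_p^μ ∂_q^ν B)`.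
(Any multi-index contributing to the sum has all entries `≤ n`, so the sum below over
`μ ν : Fin d → Fin (n+1)` captures exactly the nonzero part of this sum.) -/
noncomputable def Pop {d : ℕ} (n : ℕ) (A B : Rpoly d) : Rpoly d :=
  ∑ μ : Fin d → Fin (n + 1), ∑ ν : Fin d → Fin (n + 1),
    if (∑ k, (μ k : ℕ)) + (∑ k, (ν k : ℕ)) = n then
      C (((n.factorial : ℂ) /
            (((∏ k, Nat.factorial (μ k)) * ∏ k, Nat.factorial (ν k) : ℕ) : ℂ)) *
          (-1 : ℂ) ^ (∑ k, (ν k : ℕ))) *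
        pdMulti PVar.q (fun k => (μ k : ℕ)) (pdMulti PVar.p (fun k => (ν k : ℕ)) A) *
        pdMulti PVar.p (fun k => (μ k : ℕ)) (pdMulti PVar.q (fun k => (ν k : ℕ)) B)
    else 0

/-- The Poisson bracket `{A,B} = P^1(A,B) = Σ_k (∂_{q_k}A·∂_{p_k}B − ∂_{p_k}A·∂_{q_k}B)`. -/
noncomputable def poisson {d : ℕ} (A B : Rpoly d) : Rpoly d :=
  ∑ k : Fin d, (pd (PVar.q k) A * pd (PVar.p k) B - pd (PVar.p k) A * pd (PVar.q k) B)

/-- The Moyal bracket `{A,B}_M = Σ_{k≥0} ((−1)^k (ħ/2)^{2k}/(2k+1)!) P^{2k+1}(A,B)`.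
On polynomials this series is a finite sum: all terms with `2k+1` exceeding the total
degree vanish, so the truncation below equals the full series. -/
noncomputable def moyal {d : ℕ} (A B : Rpoly d) : Rpoly d :=
  ∑ k ∈ Finset.range (A.totalDegree + B.totalDegree + 1),
    C ((-1 : ℂ) ^ k / ((2 * k + 1).factorial : ℂ)) *
      (C (1 / 2 : ℂ) * hbar d) ^ (2 * k) * Pop (2 * k + 1) A B

/-- The Moyal star product `A⋆B = Σ_{k≥0} (1/k!)(iħ/2)^k P^k(A,B)`.
On polynomials this series is a finite sum: all terms with `k` exceeding the total
degree vanish, so the truncation below equals the full series. -/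
noncomputable def starP {d : ℕ} (A B : Rpoly d) : Rpoly d :=
  ∑ k ∈ Finset.range (A.totalDegree + B.totalDegree + 1),
    C ((k.factorial : ℂ))⁻¹ * (C (Complex.I / 2) * hbar d) ^ k * Pop k A B

/-- The Moyal adjoint `Mad_W A = {W,A}_M`. -/
noncomputable def Mad {d : ℕ} (W A : Rpoly d) : Rpoly d := moyal W A

/-- The weight of a variable: `q_k, p_k` have weight 1, `ħ` has weight 2. -/
def wtv {d : ℕ} : PVar d → ℕ
  | .h => 2
  | .q _ => 1
  | .p _ => 1

/-- The weight `2j + |α| + |β|` of a monomial `ħ^j q^α p^β` with exponent data `m`. -/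
def wt {d : ℕ} (m : PVar d →₀ ℕ) : ℕ := m.sum fun v e => wtv v * e

/-- The space `𝒲^s`: the ℂ-linear span of the monomials `ħ^j q^α p^β` with
`2j+|α|+|β| = s`; it is `{0}` for `s < 0`. -/
noncomputable def Wgr (d : ℕ) (s : ℤ) : Submodule ℂ (Rpoly d) :=
  Submodule.span ℂ {P : Rpoly d | ∃ m : PVar d →₀ ℕ, (wt m : ℤ) = s ∧ P = monomial m 1}

/-- The quadratic part `H₂ = λ·x₁ξ₁ + i·Σ_{k=2}^d ω_k·x_k ξ_k` at a nonresonant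
saddle-centre-⋯-centre equilibrium point, written in the complexified coordinates.
Here the polynomial ring has `d+1` degrees of freedom: `PVar.q k` plays the role of
`x_{k+1}` and `PVar.p k` the role of `ξ_{k+1}`; the saddle variable has index `0` and
the `d` centre frequencies are `ω i`, `i : Fin d`. -/
noncomputable def H2saddle (d : ℕ) (lam : ℝ) (ω : Fin d → ℝ) : Rpoly (d + 1) :=
  C (lam : ℂ) * X (PVar.q 0) * X (PVar.p 0) +
    ∑ i : Fin d, C (Complex.I * (ω i : ℂ)) * X (PVar.q i.succ) * X (PVar.p i.succ)

/-- The monomial `ħ^j x^α ξ^β`. -/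
noncomputable def mono (d : ℕ) (j : ℕ) (α β : Fin (d + 1) → ℕ) : Rpoly (d + 1) :=
  hbar (d + 1) ^ j * (∏ k, X (PVar.q k) ^ α k) * ∏ k, X (PVar.p k) ^ β k

/-- The recursively transformed weighted-homogeneous terms of the symbol:
`qnfSeq W H m s` is `H^{(m+2)}_s`; that is, `qnfSeq W H 0 = H = H^{(2)}` and, for
`n = m+3 ≥ 3`, `H^{(n)}_s = Σ_{k=0}^{⌊s/(n−2)⌋} (1/k!)·(Mad_{W_n})^k H^{(n−1)}_{s−k(n−2)}`
(no negative indices occur, since `k(n−2) ≤ s` throughout the sum). -/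
noncomputable def qnfSeq {d : ℕ} (W : ℕ → Rpoly d) (H : ℕ → Rpoly d) : ℕ → ℕ → Rpoly d
  | 0, s => H s
  | m + 1, s =>
    ∑ k ∈ Finset.range (s / (m + 1) + 1),
      ((k.factorial : ℂ))⁻¹ • (Mad (W (m + 3)))^[k] (qnfSeq W H m (s - k * (m + 1)))

section Grading

variable {d : ℕ}

theorem wt_add (m n : PVar d →₀ ℕ) : wt (m + n) = wt m + wt n :=
  Finsupp.sum_add_index' (fun _ => mul_zero _) (fun _ _ _ => mul_add _ _ _)

theorem wt_single (v : PVar d) (e : ℕ) : wt (Finsupp.single v e) = wtv v * e :=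
  Finsupp.sum_single_index (mul_zero _)

theorem monomial_mem_Wgr {s : ℤ} {m : PVar d →₀ ℕ} (hm : (wt m : ℤ) = s) (c : ℂ) :
    (monomial m c : Rpoly d) ∈ Wgr d s := by
  have h : (monomial m c : Rpoly d) = c • monomial m 1 := by simp [smul_monomial]
  rw [h]
  exact Submodule.smul_mem _ _ (Submodule.subset_span ⟨m, hm, rfl⟩)

theorem C_mem_Wgr (c : ℂ) : (C c : Rpoly d) ∈ Wgr d 0 :=
  monomial_mem_Wgr (by simp [wt]) c

theorem X_mem_Wgr (v : PVar d) : (X v : Rpoly d) ∈ Wgr d (wtv v : ℤ) :=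
  monomial_mem_Wgr (by simp [wt_single]) 1

theorem mul_mem_Wgr {s t : ℤ} {A B : Rpoly d} (hA : A ∈ Wgr d s) (hB : B ∈ Wgr d t) :
    A * B ∈ Wgr d (s + t) := by
  induction hA using Submodule.span_induction with
  | zero => simp
  | add x y _ _ hx hy => rw [add_mul]; exact Submodule.add_mem _ hx hy
  | smul a x _ hx => rw [smul_mul_assoc]; exact Submodule.smul_mem _ _ hx
  | mem x hx =>
    obtain ⟨m, rfl, rfl⟩ := hx
    induction hB using Submodule.span_induction with
    | zero => simp
    | add x y _ _ hx hy => rw [mul_add]; exact Submodule.add_mem _ hx hy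
    | smul a x _ hx => rw [mul_smul_comm]; exact Submodule.smul_mem _ _ hx
    | mem y hy =>
      obtain ⟨n, rfl, rfl⟩ := hy
      rw [monomial_mul]
      exact monomial_mem_Wgr (by simp [wt_add]) _

theorem pow_mem_Wgr {s : ℤ} {A : Rpoly d} (hA : A ∈ Wgr d s) (n : ℕ) :
    A ^ n ∈ Wgr d (n * s) := by
  induction n with
  | zero => simpa using C_mem_Wgr (d := d) 1
  | succ n ih =>
    rw [pow_succ]
    convert mul_mem_Wgr ih hA using 1
    push_cast
    ring_nf

theorem pd_mem_Wgr (v : PVar d) {s : ℤ} {A : Rpoly d} (hA : A ∈ Wgr d s) :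
    pd v A ∈ Wgr d (s - wtv v) := by
  induction hA using Submodule.span_induction with
  | zero => simp
  | add x y _ _ hx hy => rw [map_add]; exact Submodule.add_mem _ hx hy
  | smul a x _ hx => rw [map_smul]; exact Submodule.smul_mem _ _ hx
  | mem x hx =>
    obtain ⟨m, rfl, rfl⟩ := hx
    change pderiv v (monomial m 1) ∈ _
    rw [pderiv_monomial]
    rcases Nat.eq_zero_or_pos (m v) with h | h
    · simp [h]
    · apply monomial_mem_Wgr
      have hle : Finsupp.single v 1 ≤ m := by simpa [Nat.one_le_iff_ne_zero, Nat.pos_iff_ne_zero] using h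
      conv_rhs => rw [← tsub_add_cancel_of_le hle, wt_add, wt_single]
      simp

theorem pd_pow_mem_Wgr (v : PVar d) (hv : wtv v = 1) (n : ℕ) {s : ℤ} {A : Rpoly d}
    (hA : A ∈ Wgr d s) : (pd v ^ n) A ∈ Wgr d (s - n) := by
  induction n with
  | zero => simpa using hA
  | succ n ih =>
    rw [pow_succ', Module.End.mul_apply]
    convert pd_mem_Wgr v ih using 1
    rw [hv]
    push_cast
    ring_nf

theorem prod_pd_pow_mem_Wgr {ι : Type*} (f : ι → PVar d) (hf : ∀ k, wtv (f k) = 1) (μ : ι → ℕ)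
    (l : List ι) {s : ℤ} {A : Rpoly d} (hA : A ∈ Wgr d s) :
    (l.map fun k => pd (f k) ^ μ k).prod A ∈ Wgr d (s - ((l.map μ).sum : ℕ)) := by
  induction l with
  | nil => simpa using hA
  | cons k l ih =>
    rw [List.map_cons, List.map_cons, List.prod_cons, Module.End.mul_apply]
    convert pd_pow_mem_Wgr (f k) (hf k) (μ k) ih using 1
    rw [List.sum_cons]
    push_cast
    ring_nf

theorem pdMulti_mem_Wgr (f : Fin d → PVar d) (hf : ∀ k, wtv (f k) = 1) (μ : Fin d → ℕ)
    {s : ℤ} {A : Rpoly d} (hA : A ∈ Wgr d s) :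
    pdMulti f μ A ∈ Wgr d (s - (∑ k, μ k : ℕ)) := by
  have h := prod_pd_pow_mem_Wgr f hf μ (List.finRange d) hA
  rwa [← List.ofFn_eq_map, ← List.ofFn_eq_map, List.sum_ofFn] at h

theorem eq_zero_of_mem_Wgr_of_neg {s : ℤ} (hs : s < 0) {A : Rpoly d} (hA : A ∈ Wgr d s) :
    A = 0 := by
  have h : {P : Rpoly d | ∃ m : PVar d →₀ ℕ, (wt m : ℤ) = s ∧ P = monomial m 1} = ∅ := by
    ext P
    simp only [Set.mem_ofPred_eq, Set.mem_empty_iff_false, iff_false]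
    rintro ⟨m, hm, -⟩
    omega
  rwa [Wgr, h, Submodule.span_empty, Submodule.mem_bot] at hA

theorem Pop_mem_Wgr (n : ℕ) {s t : ℤ} {A B : Rpoly d} (hA : A ∈ Wgr d s) (hB : B ∈ Wgr d t) :
    Pop n A B ∈ Wgr d (s + t - 2 * n) := by
  refine Submodule.sum_mem _ fun μ _ => Submodule.sum_mem _ fun ν _ => ?_
  split_ifs with h
  · have hA' := pdMulti_mem_Wgr PVar.q (fun _ => rfl) (fun k => (μ k : ℕ))
      (pdMulti_mem_Wgr PVar.p (fun _ => rfl) (fun k => (ν k : ℕ)) hA)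
    have hB' := pdMulti_mem_Wgr PVar.p (fun _ => rfl) (fun k => (μ k : ℕ))
      (pdMulti_mem_Wgr PVar.q (fun _ => rfl) (fun k => (ν k : ℕ)) hB)
    convert mul_mem_Wgr (mul_mem_Wgr (C_mem_Wgr _) hA') hB' using 2
    linarith [(Nat.cast_inj (R := ℤ)).2 h, Nat.cast_add (R := ℤ) (∑ k, (μ k : ℕ)) (∑ k, (ν k : ℕ))]
  · exact Submodule.zero_mem _

theorem Pop_eq_zero_of_lt {n : ℕ} (A : Rpoly d) {t : ℤ} {B : Rpoly d} (hB : B ∈ Wgr d t)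
    (hn : t < n) : Pop n A B = 0 := by
  refine Finset.sum_eq_zero fun μ _ => Finset.sum_eq_zero fun ν _ => ?_
  split_ifs with h
  · have hB' := pdMulti_mem_Wgr PVar.p (fun _ => rfl) (fun k => (μ k : ℕ))
      (pdMulti_mem_Wgr PVar.q (fun _ => rfl) (fun k => (ν k : ℕ)) hB)
    rw [eq_zero_of_mem_Wgr_of_neg (by omega) hB', mul_zero]
  · rfl

theorem Mad_mem_Wgr {s t : ℤ} {A B : Rpoly d} (hA : A ∈ Wgr d s) (hB : B ∈ Wgr d t) :
    Mad A B ∈ Wgr d (s + t - 2) := by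
  rw [Mad, moyal]
  refine Submodule.sum_mem _ fun k _ => ?_
  have hh : hbar d ∈ Wgr d 2 := X_mem_Wgr PVar.h
  convert mul_mem_Wgr (mul_mem_Wgr (C_mem_Wgr _)
    (pow_mem_Wgr (mul_mem_Wgr (C_mem_Wgr _) hh) (2 * k))) (Pop_mem_Wgr (2 * k + 1) hA hB) using 2
  push_cast
  ring

theorem iterate_Mad_mem_Wgr {n : ℕ} {t : ℤ} {A B : Rpoly d} (hA : A ∈ Wgr d (n + 2))
    (hB : B ∈ Wgr d t) (k : ℕ) : (Mad A)^[k] B ∈ Wgr d (t + k * n) := by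
  induction k with
  | zero => simpa using hB
  | succ k ih =>
    rw [Function.iterate_succ_apply']
    convert Mad_mem_Wgr hA ih using 2
    push_cast
    ring

theorem Mad_eq_zero (A : Rpoly d) {B : Rpoly d} (hB : B ∈ Wgr d 0) : Mad A B = 0 := by
  rw [Mad, moyal]
  exact Finset.sum_eq_zero fun k _ => by rw [Pop_eq_zero_of_lt A hB (by omega), mul_zero]

theorem iterate_Mad_eq_zero (A : Rpoly d) {B : Rpoly d} (hB : B ∈ Wgr d 0) {k : ℕ} (hk : k ≠ 0) :
    (Mad A)^[k] B = 0 := by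
  obtain ⟨k, rfl⟩ := Nat.exists_eq_succ_of_ne_zero hk
  rw [Function.iterate_succ_apply, Mad_eq_zero A hB]
  exact Function.iterate_fixed (Mad_eq_zero A (Submodule.zero_mem _)) k

end Grading

section Poisson

variable {d : ℕ}

theorem pdMulti_zero (f : Fin d → PVar d) : pdMulti f (fun _ => 0) = 1 :=
  List.prod_eq_one (by simp)

theorem pdMulti_single (f : Fin d → PVar d) (k : Fin d) :
    pdMulti f (Pi.single k 1) = pd (f k) := by
  rw [pdMulti, List.ofFn_eq_map, List.prod_map_eq_pow_single k]
  · rw [List.count_eq_one_of_mem (List.nodup_finRange d) (List.mem_finRange k)]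
    simp
  · intro j hj _
    simp [hj]

theorem exists_eq_single_of_sum_eq_one {ι : Type*} [Fintype ι] [DecidableEq ι] {μ : ι → ℕ}
    (h : ∑ k, μ k = 1) : ∃ k, μ = Pi.single k 1 := by
  obtain ⟨k, -, hk⟩ : ∃ k ∈ Finset.univ, μ k ≠ 0 :=
    Finset.exists_ne_zero_of_sum_ne_zero (by omega)
  have hs := Finset.add_sum_erase Finset.univ μ (Finset.mem_univ k)
  have h0 : ∑ j ∈ Finset.univ.erase k, μ j = 0 := by omega
  refine ⟨k, funext fun j => ?_⟩
  rcases eq_or_ne j k with rfl | hj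
  · rw [Pi.single_eq_same]
    omega
  · rw [Pi.single_eq_of_ne hj]
    exact Finset.sum_eq_zero_iff.1 h0 j (by simp [hj])

theorem val_single_one (k : Fin d) :
    (fun j => ((Pi.single k 1 : Fin d → Fin 2) j : ℕ)) = Pi.single k 1 := by
  funext j
  rcases eq_or_ne j k with rfl | hj
  · simp
  · simp [hj]

theorem Pop_one (A B : Rpoly d) : Pop 1 A B = poisson A B := by
  let e : Fin d ⊕ Fin d → (Fin d → Fin 2) × (Fin d → Fin 2) :=
    Sum.elim (fun k => (Pi.single k 1, 0)) (fun k => (0, Pi.single k 1))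
  have single_inj {i j : Fin d} (h : (Pi.single i 1 : Fin d → Fin 2) = Pi.single j 1) : i = j := by
    by_contra hij
    have := congrFun h i
    simp [hij] at this
  have single_ne (i : Fin d) : (Pi.single i 1 : Fin d → Fin 2) ≠ 0 := by simp
  have he : Function.Injective e := by
    rintro (i | i) (j | j) h
    · rw [single_inj (Prod.ext_iff.1 h).1]
    · exact absurd (Prod.ext_iff.1 h).1 (single_ne i)
    · exact absurd (Prod.ext_iff.1 h).2 (single_ne i)
    · rw [single_inj (Prod.ext_iff.1 h).2]
  have of_sum_zero {μ : Fin d → Fin 2} (h : ∑ k, (μ k : ℕ) = 0) : μ = 0 := by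
    funext k
    exact Fin.ext (Finset.sum_eq_zero_iff.1 h k (Finset.mem_univ k))
  have of_sum_one {μ : Fin d → Fin 2} (h : ∑ k, (μ k : ℕ) = 1) : ∃ k, Pi.single k 1 = μ := by
    obtain ⟨k, hk⟩ := exists_eq_single_of_sum_eq_one h
    refine ⟨k, funext fun j => Fin.ext ?_⟩
    rw [congrFun hk j]
    exact congrFun (val_single_one k) j
  rw [Pop, ← Fintype.sum_prod_type', poisson, Finset.sum_sub_distrib, sub_eq_add_neg,
    ← Finset.sum_neg_distrib]
  symm
  refine (Fintype.sum_sum_type (Sum.elim (fun k => pd (PVar.q k) A * pd (PVar.p k) B)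
    (fun k => -(pd (PVar.p k) A * pd (PVar.q k) B)))).symm.trans ?_
  apply Fintype.sum_of_injective e he
  · rintro ⟨μ, ν⟩ hi
    rw [if_neg]
    intro h
    dsimp only at h
    apply hi
    rcases Nat.eq_zero_or_pos (∑ k, (ν k : ℕ)) with h0 | h0
    · obtain ⟨k, rfl⟩ := of_sum_one (μ := μ) (by omega)
      exact ⟨Sum.inl k, by rw [of_sum_zero h0]; rfl⟩
    · obtain ⟨k, rfl⟩ := of_sum_one (μ := ν) (by omega)
      exact ⟨Sum.inr k, by rw [of_sum_zero (μ := μ) (by omega)]; rfl⟩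
  · have hfac (k : Fin d) :
        ∏ j, Nat.factorial ((Pi.single k 1 : Fin d → Fin 2) j : ℕ) = 1 := by
      refine Finset.prod_eq_one fun j _ => ?_
      rcases eq_or_ne j k with rfl | hj
      · simp
      · simp [hj]
    rintro (k | k)
    · simp only [e, Sum.elim_inl, val_single_one, hfac, Pi.zero_apply, pdMulti_single,
        Fin.val_zero, pdMulti_zero]
      simp
    · simp only [e, Sum.elim_inr, val_single_one, hfac, Pi.zero_apply, pdMulti_single,
        Fin.val_zero, pdMulti_zero]
      simp

theorem poisson_antisymm (A B : Rpoly d) : poisson A B = -poisson B A := by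
  rw [poisson, poisson, ← Finset.sum_neg_distrib]
  exact Finset.sum_congr rfl fun k _ => by ring

theorem poisson_self (A : Rpoly d) : poisson A A = 0 :=
  Finset.sum_eq_zero fun k _ => by ring

theorem poisson_add_right (A B D : Rpoly d) : poisson A (B + D) = poisson A B + poisson A D := by
  rw [poisson, poisson, poisson, ← Finset.sum_add_distrib]
  exact Finset.sum_congr rfl fun k _ => by rw [map_add, map_add]; ring

theorem poisson_smul_right (A : Rpoly d) (c : ℂ) (B : Rpoly d) :
    poisson A (c • B) = c • poisson A B := by
  rw [poisson, poisson, Finset.smul_sum]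
  exact Finset.sum_congr rfl fun k _ => by
    rw [map_smul, map_smul, mul_smul_comm, mul_smul_comm, smul_sub]

theorem poisson_zero_right (A : Rpoly d) : poisson A 0 = 0 := by
  simp [poisson]

theorem poisson_eq_zero_of_mem_Wgr_zero (A : Rpoly d) {B : Rpoly d} (hB : B ∈ Wgr d 0) :
    poisson A B = 0 := by
  rw [← Pop_one]
  exact Pop_eq_zero_of_lt A hB (by norm_num)

theorem Mad_eq_poisson (A : Rpoly d) {B : Rpoly d} (hB : B ∈ Wgr d 2) :
    Mad A B = poisson A B := by
  rw [Mad, moyal, Finset.sum_eq_single_of_mem 0 (by simp)]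
  · simp [Pop_one]
  · intro k _ hk
    rw [Pop_eq_zero_of_lt A hB (by omega), mul_zero]

end Poisson

section Quadratic

variable {d : ℕ}

/-- The quadratic polynomial `Σ_k Λ_k·q_k p_k`. -/
noncomputable def quadDiag (L : Fin d → ℂ) : Rpoly d :=
  ∑ k, C (L k) * X (PVar.q k) * X (PVar.p k)

theorem H2saddle_eq_quadDiag (d : ℕ) (lam : ℝ) (ω : Fin d → ℝ) :
    H2saddle d lam ω =
      quadDiag (Fin.cons (lam : ℂ) fun i => Complex.I * (ω i : ℂ) : Fin (d + 1) → ℂ) := by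
  simp [H2saddle, quadDiag, Fin.sum_univ_succ]

theorem pd_q_quadDiag (L : Fin d → ℂ) (k : Fin d) :
    pd (PVar.q k) (quadDiag L) = C (L k) * X (PVar.p k) := by
  change pderiv _ _ = _
  rw [quadDiag, map_sum, Finset.sum_eq_single_of_mem k (Finset.mem_univ k)]
  · simp [pderiv_X, mul_comm]
  · intro j _ hj
    simp [pderiv_X, hj]

theorem pd_p_quadDiag (L : Fin d → ℂ) (k : Fin d) :
    pd (PVar.p k) (quadDiag L) = C (L k) * X (PVar.q k) := by
  change pderiv _ _ = _
  rw [quadDiag, map_sum, Finset.sum_eq_single_of_mem k (Finset.mem_univ k)]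
  · simp [pderiv_X]
  · intro j _ hj
    simp [pderiv_X, hj]

theorem poisson_quadDiag_monomial (L : Fin d → ℂ) (m : PVar d →₀ ℕ) (c : ℂ) :
    poisson (quadDiag L) (monomial m c) =
      (∑ k, L k * ((m (PVar.p k) : ℂ) - m (PVar.q k))) • monomial m c := by
  rw [poisson, Finset.sum_smul]
  refine Finset.sum_congr rfl fun k _ => ?_
  rw [pd_q_quadDiag, pd_p_quadDiag, mul_assoc, mul_assoc]
  change C (L k) * (X (PVar.p k) * pderiv (PVar.p k) (monomial m c)) -
    C (L k) * (X (PVar.q k) * pderiv (PVar.q k) (monomial m c)) = _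
  rw [X_mul_pderiv_monomial, X_mul_pderiv_monomial, ← mul_sub, ← smul_eq_C_mul, mul_smul, sub_smul,
    Nat.cast_smul_eq_nsmul, Nat.cast_smul_eq_nsmul]

/-- Solvability of the homological equation: `ad_Q` is semisimple on each graded piece. -/
theorem exists_poisson_quadDiag_add_eq_zero (L : Fin d → ℂ) {s : ℤ} {K : Rpoly d}
    (hK : K ∈ Wgr d s) :
    ∃ W ∈ Wgr d s, poisson (quadDiag L) (K + poisson W (quadDiag L)) = 0 := by
  induction hK using Submodule.span_induction with
  | zero => exact ⟨0, Submodule.zero_mem _, by simp [poisson]⟩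
  | add x y _ _ hx hy =>
    obtain ⟨V, hV, hV'⟩ := hx
    obtain ⟨W, hW, hW'⟩ := hy
    refine ⟨V + W, Submodule.add_mem _ hV hW, ?_⟩
    rw [← add_zero (0 : Rpoly d)]
    nth_rw 1 [← hV']
    rw [← hW', ← poisson_add_right, poisson_antisymm (V + W), poisson_antisymm V, poisson_antisymm W,
      poisson_add_right _ V W]
    congr 1
    abel
  | smul a x _ hx =>
    obtain ⟨V, hV, hV'⟩ := hx
    refine ⟨a • V, Submodule.smul_mem _ _ hV, ?_⟩
    rw [poisson_antisymm (a • V), poisson_smul_right, ← smul_neg, ← smul_add,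
      ← poisson_antisymm, poisson_smul_right, hV', smul_zero]
  | mem x hx =>
    obtain ⟨m, hm, rfl⟩ := hx
    set c : ℂ := ∑ k, L k * ((m (PVar.p k) : ℂ) - m (PVar.q k)) with hc
    rcases eq_or_ne c 0 with h0 | h0
    · refine ⟨0, Submodule.zero_mem _, ?_⟩
      rw [poisson_antisymm 0, poisson_zero_right, neg_zero, add_zero, poisson_quadDiag_monomial,
        ← hc, h0, zero_smul]
    · refine ⟨c⁻¹ • monomial m 1, Submodule.smul_mem _ _ (monomial_mem_Wgr hm 1), ?_⟩
      rw [poisson_antisymm (c⁻¹ • _), poisson_smul_right, poisson_quadDiag_monomial, ← hc,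
        inv_smul_smul₀ h0, add_neg_cancel, poisson_zero_right]

end Quadratic

section Recursion

variable {d : ℕ}

theorem qnfSeq_congr {W W' : ℕ → Rpoly d} (H : ℕ → Rpoly d) {m : ℕ}
    (h : ∀ n ≤ m + 2, W n = W' n) (s : ℕ) : qnfSeq W H m s = qnfSeq W' H m s := by
  induction m generalizing s with
  | zero => rfl
  | succ m ih =>
    rw [qnfSeq, qnfSeq, h (m + 3) le_rfl]
    exact Finset.sum_congr rfl fun k _ => by rw [ih fun n hn => h n (by omega)]

theorem qnfSeq_succ_mem_Wgr {W H : ℕ → Rpoly d} {m : ℕ} (hW : W (m + 3) ∈ Wgr d ((m + 3 : ℕ) : ℤ))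
    (hm : ∀ s : ℕ, qnfSeq W H m s ∈ Wgr d s) (s : ℕ) : qnfSeq W H (m + 1) s ∈ Wgr d s := by
  rw [qnfSeq]
  refine Submodule.sum_mem _ fun k hk => Submodule.smul_mem _ _ ?_
  have hks : k * (m + 1) ≤ s :=
    (Nat.le_div_iff_mul_le m.succ_pos).1 (Nat.lt_succ_iff.1 (Finset.mem_range.1 hk))
  have hW' : W (m + 3) ∈ Wgr d ((m + 1 : ℕ) + 2) := by
    exact_mod_cast hW
  convert iterate_Mad_mem_Wgr hW' (hm (s - k * (m + 1))) k using 2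
  rw [Nat.cast_sub hks]
  push_cast
  ring

theorem iterate_Mad_qnfSeq_eq_zero {W H : ℕ → Rpoly d} {m t k : ℕ} (hm0 : qnfSeq W H m 0 ∈ Wgr d 0)
    (hm1 : qnfSeq W H m 1 = 0) (ht : t < 2) (hk : k ≠ 0) (A : Rpoly d) :
    (Mad A)^[k] (qnfSeq W H m t) = 0 := by
  apply iterate_Mad_eq_zero A _ hk
  interval_cases t
  · exact hm0
  · rw [hm1]
    exact Submodule.zero_mem _

theorem qnfSeq_succ_of_le {W H : ℕ → Rpoly d} {m s : ℕ} (hm0 : qnfSeq W H m 0 ∈ Wgr d 0)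
    (hm1 : qnfSeq W H m 1 = 0) (hs : s ≤ m + 2) : qnfSeq W H (m + 1) s = qnfSeq W H m s := by
  rw [qnfSeq, Finset.sum_eq_single_of_mem 0 (by simp)]
  · simp
  · intro k _ hk
    have : 1 * (m + 1) ≤ k * (m + 1) := Nat.mul_le_mul_right _ (by omega)
    rw [iterate_Mad_qnfSeq_eq_zero hm0 hm1 (by omega) hk, smul_zero]

theorem qnfSeq_succ_top {W H : ℕ → Rpoly d} {m : ℕ} (hm0 : qnfSeq W H m 0 ∈ Wgr d 0)
    (hm1 : qnfSeq W H m 1 = 0) :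
    qnfSeq W H (m + 1) (m + 3) = qnfSeq W H m (m + 3) + Mad (W (m + 3)) (qnfSeq W H m 2) := by
  have h1 : 1 ≤ (m + 3) / (m + 1) := (Nat.le_div_iff_mul_le m.succ_pos).2 (by omega)
  have hsub : m + 3 - (m + 1) = 2 := by omega
  rw [qnfSeq, ← Finset.sum_subset (s₁ := Finset.range 2)
    (Finset.range_subset_range.2 (by omega))]
  · simp [Finset.sum_range_succ, hsub]
  · intro k _ hk
    have hk2 : 2 ≤ k := by simpa [Nat.succ_le_iff] using hk
    have : 2 * (m + 1) ≤ k * (m + 1) := Nat.mul_le_mul_right _ hk2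
    rw [iterate_Mad_qnfSeq_eq_zero hm0 hm1 (by omega) (by omega), smul_zero]

theorem quadDiag_mem_Wgr (L : Fin d → ℂ) : quadDiag L ∈ Wgr d 2 := by
  rw [quadDiag]
  refine Submodule.sum_mem _ fun k _ => ?_
  have h :=
    mul_mem_Wgr (mul_mem_Wgr (C_mem_Wgr (L k)) (X_mem_Wgr (PVar.q k))) (X_mem_Wgr (PVar.p k))
  simpa [wtv] using h

theorem exists_qnfSeq_poisson_quadDiag_eq_zero (L : Fin d → ℂ) {H : ℕ → Rpoly d}
    (hH : ∀ s : ℕ, H s ∈ Wgr d s) (hH1 : H 1 = 0) (hH2 : H 2 = quadDiag L) (m : ℕ) :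
    ∃ W : ℕ → Rpoly d,
      (∀ n, 3 ≤ n → n ≤ m + 2 → W n ∈ Wgr d n) ∧
      (∀ s : ℕ, qnfSeq W H m s ∈ Wgr d s) ∧
      qnfSeq W H m 1 = 0 ∧ qnfSeq W H m 2 = quadDiag L ∧
      ∀ s ≤ m + 2, poisson (quadDiag L) (qnfSeq W H m s) = 0 := by
  induction m with
  | zero =>
    refine ⟨0, fun n h h' => by omega, hH, hH1, hH2, fun s hs => ?_⟩
    rw [qnfSeq]
    interval_cases s
    · exact poisson_eq_zero_of_mem_Wgr_zero _ (hH 0)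
    · rw [hH1, poisson_zero_right]
    · rw [hH2, poisson_self]
  | succ m ih =>
    obtain ⟨W₀, hW₀, hmem₀, h1₀, h2₀, hcomm₀⟩ := ih
    obtain ⟨V, hV, hVcomm⟩ := exists_poisson_quadDiag_add_eq_zero L (hmem₀ (m + 3))
    let W := Function.update W₀ (m + 3) V
    have hWtop : W (m + 3) = V := Function.update_self ..
    have hWne {n : ℕ} (hn : n ≤ m + 2) : W n = W₀ n := Function.update_of_ne (by omega) ..
    have hcongr : qnfSeq W H m = qnfSeq W₀ H m := funext (qnfSeq_congr H fun n hn => hWne hn)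
    rw [← hcongr] at hmem₀ h1₀ h2₀ hcomm₀ hVcomm
    have hstep {s : ℕ} (hs : s ≤ m + 2) := qnfSeq_succ_of_le (hmem₀ 0) h1₀ hs
    refine ⟨W, fun n h h' => ?_, qnfSeq_succ_mem_Wgr (by rwa [hWtop]) hmem₀, ?_, ?_,
      fun s hs => ?_⟩
    · rcases (show n ≤ m + 2 ∨ n = m + 3 by omega) with hn | rfl
      · rw [hWne hn]
        exact hW₀ n h hn
      · rwa [hWtop]
    · rw [hstep (by omega), h1₀]
    · rw [hstep (by omega), h2₀]
    · rcases (show s ≤ m + 2 ∨ s = m + 3 by omega) with hs | rfl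
      · rw [hstep hs, hcomm₀ s hs]
      · rw [qnfSeq_succ_top (hmem₀ 0) h1₀, h2₀, hWtop, Mad_eq_poisson V (quadDiag_mem_Wgr L),
          hVcomm]

end Recursion

/-- Existence of the `N`-th order quantum normal form at the level of
symbols. Given a symbol with weighted-homogeneous components `H_s ∈ 𝒲^s`, `H₁ = 0` and
quadratic part `H₂` of saddle-centre-⋯-centre type (`λ ≠ 0`), for every `N ≥ 3` there
are generators `W₃ ∈ 𝒲³, …, W_N ∈ 𝒲^N` such that the recursively transformed terms
`H^{(N)}_s` Poisson-commute with `H₂` for all `0 ≤ s ≤ N`. -/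
theorem exists_quantum_normal_form (d : ℕ) (lam : ℝ) (hlam : lam ≠ 0) (ω : Fin d → ℝ)
    (H : ℕ → Rpoly (d + 1)) (hH : ∀ s : ℕ, H s ∈ Wgr (d + 1) (s : ℤ))
    (hH1 : H 1 = 0) (hH2 : H 2 = H2saddle d lam ω) (N : ℕ) (hN : 3 ≤ N) :
    ∃ W : ℕ → Rpoly (d + 1),
      (∀ n, 3 ≤ n → n ≤ N → W n ∈ Wgr (d + 1) (n : ℤ)) ∧
      ∀ s ≤ N, poisson (H2saddle d lam ω) (qnfSeq W H (N - 2) s) = 0 := by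
  rw [H2saddle_eq_quadDiag] at hH2 ⊢
  obtain ⟨W, hW, -, -, -, hcomm⟩ := exists_qnfSeq_poisson_quadDiag_eq_zero _ hH hH1 hH2 (N - 2)
  exact ⟨W, fun n h h' => hW n h (by omega), fun s hs => hcomm s (by omega)⟩
end

section
/- (Expansion of powers of J in star powers; Lemma on Op[Jⁿ].) Let d = 1 and J := (p² + q²)/2 ∈ R. Define integers Γ_{n,k} for n ∈ ℕ, k ∈ ℤ by Γ_{n,k} = 0 if k < 0 or 2k > n, Γ_{n,0} = 1 for all n, and the recursion Γ_{n+1,k} = Γ_{n,k} + n²·Γ_{n−1,k−1} for k ≥ 1. Then for every n ∈ ℕ, the ordinary n-th power of J satisfies Jⁿ = Σ_{k=0}^{⌊n/2⌋} Γ_{n,k} · (ħ/2)^{2k} · J^{⋆(n−2k)}, where J^{⋆m} denotes the m-fold star power J ⋆ J ⋆ ⋯ ⋆ J (with J^{⋆0} := 1). -/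
open MvPolynomial

/-- The `m`-fold star power `A^{⋆m} = A ⋆ A ⋆ ⋯ ⋆ A`, with `A^{⋆0} = 1`. -/
noncomputable def starPow (A : Rpoly 1) : ℕ → Rpoly 1
  | 0 => 1
  | m + 1 => starP A (starPow A m)

/-- The classical integral `J = (p² + q²)/2` for one degree of freedom. -/
noncomputable def Jcen : Rpoly 1 := C (1 / 2 : ℂ) * (X (PVar.p 0) ^ 2 + X (PVar.q 0) ^ 2)

/-- The action of `J ⋆ ·`, written as a second-order differential operator. -/
noncomputable def starJ (B : Rpoly 1) : Rpoly 1 :=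
  Jcen * B
    + C (Complex.I / 2) * hbar 1 *
      (X (PVar.q 0) * pderiv (PVar.p 0) B - X (PVar.p 0) * pderiv (PVar.q 0) B)
    - C (1 / 8 : ℂ) * hbar 1 ^ 2 *
      (pderiv (PVar.p 0) (pderiv (PVar.p 0) B) + pderiv (PVar.q 0) (pderiv (PVar.q 0) B))

theorem pderiv_p_Jcen : pderiv (PVar.p 0) Jcen = X (PVar.p 0) := by
  have h : (C (1 / 2 : ℂ) : Rpoly 1) * 2 = 1 := by
    rw [← map_ofNat (C : ℂ →+* Rpoly 1) 2, ← C_mul]; norm_num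
  simp only [Jcen, Derivation.leibniz, map_add, pderiv_C, Derivation.leibniz_pow, pderiv_X_self,
    pderiv_X_of_ne (show (PVar.q 0 : PVar 1) ≠ PVar.p 0 by simp), smul_eq_mul, nsmul_eq_mul]
  push_cast
  linear_combination (X (PVar.p 0)) * h

theorem pderiv_q_Jcen : pderiv (PVar.q 0) Jcen = X (PVar.q 0) := by
  have h : (C (1 / 2 : ℂ) : Rpoly 1) * 2 = 1 := by
    rw [← map_ofNat (C : ℂ →+* Rpoly 1) 2, ← C_mul]; norm_num
  simp only [Jcen, Derivation.leibniz, map_add, pderiv_C, Derivation.leibniz_pow, pderiv_X_self,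
    pderiv_X_of_ne (show (PVar.p 0 : PVar 1) ≠ PVar.q 0 by simp), smul_eq_mul, nsmul_eq_mul]
  push_cast
  linear_combination (X (PVar.q 0)) * h

theorem pdMulti_one (f : Fin 1 → PVar 1) (μ : Fin 1 → ℕ) : pdMulti f μ = pd (f 0) ^ μ 0 := by
  simp [pdMulti]

theorem pd_apply (v : PVar 1) (A : Rpoly 1) : pd v A = pderiv v A := rfl

theorem Pop_one_dim (n : ℕ) (A B : Rpoly 1) :
    Pop n A B = ∑ a : Fin (n + 1), ∑ b : Fin (n + 1),
      if (a : ℕ) + b = n then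
        C ((n.factorial : ℂ) / ((Nat.factorial a * Nat.factorial b : ℕ) : ℂ) * (-1 : ℂ) ^ (b : ℕ)) *
          (pd (PVar.q 0) ^ (a : ℕ)) ((pd (PVar.p 0) ^ (b : ℕ)) A) *
          (pd (PVar.p 0) ^ (a : ℕ)) ((pd (PVar.q 0) ^ (b : ℕ)) B)
      else 0 := by
  rw [Pop]
  refine Fintype.sum_equiv (Equiv.funUnique (Fin 1) (Fin (n + 1))) _ _ fun μ => ?_
  refine Fintype.sum_equiv (Equiv.funUnique (Fin 1) (Fin (n + 1))) _ _ fun ν => ?_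
  simp [pdMulti_one]

theorem pd_pow_Jcen_eq_zero {a b : ℕ} (h : 3 ≤ a + b) :
    (pd (PVar.q 0) ^ a) ((pd (PVar.p 0) ^ b) Jcen) = 0 := by
  have hpq : pderiv (PVar.q 0 : PVar 1) (X (PVar.p 0) : Rpoly 1) = 0 :=
    pderiv_X_of_ne (by simp)
  match b, h with
  | 0, h =>
    obtain ⟨c, rfl⟩ : ∃ c, a = c + 3 := ⟨a - 3, by omega⟩
    simp [pow_succ, pd_apply, pderiv_q_Jcen]
  | 1, h =>
    obtain ⟨c, rfl⟩ : ∃ c, a = c + 1 := ⟨a - 1, by omega⟩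
    simp [pow_succ, pd_apply, pderiv_p_Jcen, hpq]
  | 2, h =>
    obtain ⟨c, rfl⟩ : ∃ c, a = c + 1 := ⟨a - 1, by omega⟩
    simp [pow_succ, pd_apply, pderiv_p_Jcen]
  | b + 3, _ =>
    simp [pow_succ, pd_apply, pderiv_p_Jcen]

theorem Pop_Jcen_eq_zero {n : ℕ} (hn : 3 ≤ n) (B : Rpoly 1) : Pop n Jcen B = 0 := by
  rw [Pop_one_dim]
  refine Finset.sum_eq_zero fun a _ => Finset.sum_eq_zero fun b _ => ?_
  split_ifs with h
  · rw [pd_pow_Jcen_eq_zero (by omega), mul_zero, zero_mul]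
  · rfl

theorem two_le_totalDegree_Jcen : 2 ≤ Jcen.totalDegree := by
  have hne : (Finsupp.single (PVar.q 0 : PVar 1) 2) ≠ Finsupp.single (PVar.p 0) 2 := by
    intro h
    simpa using DFunLike.congr_fun h (PVar.q 0)
  have h : Finsupp.single (PVar.p 0 : PVar 1) 2 ∈ Jcen.support := by
    rw [mem_support_iff, Jcen, coeff_C_mul, coeff_add, coeff_X_pow, coeff_X_pow, if_pos rfl,
      if_neg hne]
    norm_num
  simpa using le_totalDegree h

theorem starP_Jcen (B : Rpoly 1) : starP Jcen B = starJ B := by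
  have hpq : pderiv (PVar.q 0 : PVar 1) (X (PVar.p 0) : Rpoly 1) = 0 :=
    pderiv_X_of_ne (by simp)
  have hsub : Finset.range 3 ⊆ Finset.range (Jcen.totalDegree + B.totalDegree + 1) :=
    Finset.range_subset_range.2 (by have := two_le_totalDegree_Jcen; omega)
  have hI : (C (Complex.I / 2) : Rpoly 1) ^ 2 * C ((2 : ℂ)⁻¹) = -C ((8 : ℂ)⁻¹) := by
    rw [← C_pow, ← C_mul, ← C_neg, div_pow, Complex.I_sq]; norm_num
  rw [starP, ← Finset.sum_subset hsub fun k _ hk => by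
    rw [Pop_Jcen_eq_zero (by simpa using hk), mul_zero]]
  simp [Finset.sum_range_succ, Pop_one_dim, Fin.sum_univ_succ, pow_succ, pd_apply,
    pderiv_p_Jcen, pderiv_q_Jcen, hpq, starJ]
  linear_combination (hbar 1 ^ 2 *
    (pderiv (PVar.p 0) (pderiv (PVar.p 0) B) + pderiv (PVar.q 0) (pderiv (PVar.q 0) B))) * hI

theorem starJ_sum {ι : Type*} (s : Finset ι) (f : ι → Rpoly 1) :
    starJ (∑ i ∈ s, f i) = ∑ i ∈ s, starJ (f i) := by
  simp only [starJ, map_sum, Finset.mul_sum, ← Finset.sum_add_distrib, ← Finset.sum_sub_distrib]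

theorem starJ_mul_of_pderiv_eq_zero {A : Rpoly 1} (hq : pderiv (PVar.q 0) A = 0)
    (hp : pderiv (PVar.p 0) A = 0) (B : Rpoly 1) : starJ (A * B) = A * starJ B := by
  simp only [starJ, Derivation.leibniz, hq, hp, smul_eq_mul, mul_zero, add_zero]
  ring

theorem starJ_Jcen_pow (n : ℕ) :
    starJ (Jcen ^ n) =
      Jcen ^ (n + 1) - (C (1 / 2 : ℂ) * hbar 1) ^ 2 * (n : Rpoly 1) ^ 2 * Jcen ^ (n - 1) := by
  have h2 : (C (1 / 2 : ℂ) : Rpoly 1) * 2 = 1 := by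
    rw [← map_ofNat (C : ℂ →+* Rpoly 1) 2, ← C_mul]; norm_num
  have h8 : (C (1 / 8 : ℂ) : Rpoly 1) = C (1 / 2 : ℂ) ^ 3 := by
    rw [← C_pow]; norm_num
  have hJ : (X (PVar.p 0) ^ 2 + X (PVar.q 0) ^ 2 : Rpoly 1) = 2 * Jcen := by
    rw [Jcen]; linear_combination -(X (PVar.p 0) ^ 2 + X (PVar.q 0) ^ 2 : Rpoly 1) * h2
  match n with
  | 0 => simp [starJ]
  | 1 =>
    simp only [starJ, pow_one, pderiv_p_Jcen, pderiv_q_Jcen, pderiv_X_self, h8, Nat.sub_self]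
    push_cast
    linear_combination -(C (1 / 2 : ℂ) ^ 2 * hbar 1 ^ 2) * h2
  | m + 2 =>
    simp only [starJ, Derivation.leibniz_pow, Derivation.leibniz, pderiv_p_Jcen, pderiv_q_Jcen,
      pderiv_X_self, h8, smul_eq_mul, nsmul_eq_mul, Derivation.map_natCast, Nat.add_sub_cancel,
      show m + 2 - 1 = m + 1 from rfl]
    push_cast
    linear_combination
      -(C (1 / 2 : ℂ) ^ 3 * hbar 1 ^ 2 * ((m : Rpoly 1) + 2) * ((m : Rpoly 1) + 1) * Jcen ^ m) * hJ
      - (C (1 / 2 : ℂ) ^ 2 * hbar 1 ^ 2 * ((m : Rpoly 1) + 2) ^ 2 * Jcen ^ (m + 1)) * h2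

theorem starJ_C_mul_hbar_pow_mul (c : ℂ) (k : ℕ) (B : Rpoly 1) :
    starJ (C c * (C (1 / 2 : ℂ) * hbar 1) ^ k * B) =
      C c * (C (1 / 2 : ℂ) * hbar 1) ^ k * starJ B := by
  have hq : pderiv (PVar.q 0 : PVar 1) (hbar 1) = 0 := pderiv_X_of_ne (by simp)
  have hp : pderiv (PVar.p 0 : PVar 1) (hbar 1) = 0 := pderiv_X_of_ne (by simp)
  apply starJ_mul_of_pderiv_eq_zero <;>
    simp only [Derivation.leibniz, Derivation.leibniz_pow, pderiv_C, hq, hp, smul_zero, add_zero]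

/-- The terms with `2k > n` vanish, so every sufficiently long sum is the claimed one. -/
theorem sum_range_eq_sum_range_half {Γ : ℕ → ℤ → ℤ}
    (hΓ0 : ∀ (n : ℕ) (k : ℤ), k < 0 ∨ (n : ℤ) < 2 * k → Γ n k = 0) {n N : ℕ} (hN : n < N)
    (f : ℕ → Rpoly 1) :
    ∑ k ∈ Finset.range N, C ((Γ n (k : ℤ) : ℂ)) * (C (1 / 2 : ℂ) * hbar 1) ^ (2 * k) * f k =
      ∑ k ∈ Finset.range (n / 2 + 1),
        C ((Γ n (k : ℤ) : ℂ)) * (C (1 / 2 : ℂ) * hbar 1) ^ (2 * k) * f k := by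
  symm
  refine Finset.sum_subset (Finset.range_subset_range.2 (by omega)) fun k _ hk => ?_
  rw [Finset.mem_range] at hk
  rw [hΓ0 n k (Or.inr (by omega))]
  simp

/-- Expansion of powers of `J` in star powers. Let `Γ_{n,k}` be the
integers with `Γ_{n,k} = 0` for `k < 0` or `2k > n`, `Γ_{n,0} = 1`, and
`Γ_{n+1,k} = Γ_{n,k} + n²·Γ_{n−1,k−1}` for `k ≥ 1`. Then
`Jⁿ = Σ_{k=0}^{⌊n/2⌋} Γ_{n,k} (ħ/2)^{2k} J^{⋆(n−2k)}`. -/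
theorem J_pow_eq_sum_star_powers (Γ : ℕ → ℤ → ℤ)
    (hΓ0 : ∀ (n : ℕ) (k : ℤ), k < 0 ∨ (n : ℤ) < 2 * k → Γ n k = 0)
    (hΓ1 : ∀ n : ℕ, Γ n 0 = 1)
    (hΓrec : ∀ (n : ℕ) (k : ℤ), 1 ≤ k →
      Γ (n + 1) k = Γ n k + (n : ℤ) ^ 2 * Γ (n - 1) (k - 1))
    (n : ℕ) :
    Jcen ^ n = ∑ k ∈ Finset.range (n / 2 + 1),
      C ((Γ n (k : ℤ) : ℂ)) * (C (1 / 2 : ℂ) * hbar 1) ^ (2 * k) *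
        starPow Jcen (n - 2 * k) := by
  induction n using Nat.strong_induction_on with
  | _ n ih =>
  match n, ih with
  | 0, _ => simp [hΓ1, starPow]
  | n + 1, ih =>
    have hJ : Jcen ^ (n + 1) = starJ (Jcen ^ n) +
        (C (1 / 2 : ℂ) * hbar 1) ^ 2 * (n : Rpoly 1) ^ 2 * Jcen ^ (n - 1) := by
      rw [starJ_Jcen_pow]; ring
    have h₁ : starJ (Jcen ^ n) = ∑ k ∈ Finset.range (n + 2),
        C ((Γ n (k : ℤ) : ℂ)) * (C (1 / 2 : ℂ) * hbar 1) ^ (2 * k) *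
          starPow Jcen (n + 1 - 2 * k) := by
      rw [sum_range_eq_sum_range_half hΓ0 (by omega), ih n (by omega), starJ_sum]
      refine Finset.sum_congr rfl fun k hk => ?_
      rw [Finset.mem_range] at hk
      rw [starJ_C_mul_hbar_pow_mul, show n + 1 - 2 * k = (n - 2 * k) + 1 by omega, starPow,
        starP_Jcen]
    have h₂ : Jcen ^ (n - 1) = ∑ k ∈ Finset.range (n + 1),
        C ((Γ (n - 1) (k : ℤ) : ℂ)) * (C (1 / 2 : ℂ) * hbar 1) ^ (2 * k) *
          starPow Jcen (n - 1 - 2 * k) := by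
      rw [sum_range_eq_sum_range_half hΓ0 (by omega), ih (n - 1) (by omega)]
    rw [← sum_range_eq_sum_range_half hΓ0 (N := n + 2) (by omega), hJ, h₁, h₂,
      Finset.sum_range_succ', Finset.sum_range_succ' _ (n + 1), Finset.mul_sum,
      add_right_comm, ← Finset.sum_add_distrib]
    congr 1
    · refine Finset.sum_congr rfl fun k _ => ?_
      rw [show ((k + 1 : ℕ) : ℤ) = (k : ℤ) + 1 by push_cast; rfl, hΓrec n (k + 1) (by omega),
        add_sub_cancel_right, show n - 1 - 2 * k = n + 1 - 2 * (k + 1) by omega]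
      simp only [Int.cast_add, Int.cast_mul, Int.cast_pow, Int.cast_natCast, map_add, map_mul,
        map_pow, map_natCast]
      ring
    · simp [hΓ1]
end
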